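/- Let D be a reduced rectangular pipe dream of shape a×b. Then D is rigid if and only if both of the following hold: (1) no cross (i,j) ∈ D has both an elbow to its north and an elbow to its east, i.e. there is no (i,j) ∈ D together with i' < i such that (i',j) ∉ D and j' > j such that (i,j') ∉ D; and (2) no cross (i,j) ∈ D has both an elbow to its south and an elbow to its west, i.e. there is no (i,j) ∈ D together with i' > i such that (i',j) ∉ D and j' < j such that (i,j') ∉ D. -/

import Mathlib

/-- The simple transposition of the symmetric group on `Fin n` exchanging the
(0-based) positions `i` and `i+1`; it is the identity if `i+1 ≥ n`. -/
def simpleTransposition (n : ℕ) (i : ℕ) : Equiv.Perm (Fin n) :=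
  if h : i + 1 < n then Equiv.swap ⟨i, Nat.lt_of_succ_lt h⟩ ⟨i + 1, h⟩ else 1

/-- The number of inversions (= Coxeter length) of a permutation of `Fin n`. -/
def invCount {n : ℕ} (π : Equiv.Perm (Fin n)) : ℕ :=
  (Finset.univ.filter (fun p : Fin n × Fin n => p.1 < p.2 ∧ π p.2 < π p.1)).card

/-- A rectangular pipe dream of shape `a × b`: a set of crosses `D` inside the grid
`{1,…,a} × {1,…,b}` (first coordinate = row, from top to bottom; second = column,
from left to right).  Positions of the grid not in `D` are elbows. -/
def IsPipeDream (a b : ℕ) (D : Finset (ℕ × ℕ)) : Prop :=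
  D ⊆ Finset.Icc 1 a ×ˢ Finset.Icc 1 b

/-- The reading word of a rectangular pipe dream of shape `a × b`: read the rows from
bottom (`i = a`) to top (`i = 1`), each row from left (`j = 1`) to right (`j = b`);
a cross at `(i,j)` contributes the simple transposition `s_{i+j-1}` of `S_{a+b}`
(recorded here by its 0-based index `i + j - 2 = (i-1) + (j-1)`). -/
def readingWord (a b : ℕ) (D : Finset (ℕ × ℕ)) : List ℕ :=
  ((List.range a).reverse.flatMap fun r =>
    (List.range b).filterMap fun c =>
      if (r + 1, c + 1) ∈ D then some (r + c) else none)

/-- The permutation of a rectangular pipe dream: the product of its reading word. -/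
def pdPerm (a b : ℕ) (D : Finset (ℕ × ℕ)) : Equiv.Perm (Fin (a + b)) :=
  ((readingWord a b D).map (simpleTransposition (a + b))).prod

/-- A pipe dream is reduced if the Coxeter length of its permutation equals its number
of crosses. -/
def IsReducedPD (a b : ℕ) (D : Finset (ℕ × ℕ)) : Prop :=
  invCount (pdPerm a b D) = D.card

/-- A reduced rectangular pipe dream is rigid if it is the unique reduced rectangular
pipe dream of its shape with its permutation. -/
def IsRigid (a b : ℕ) (D : Finset (ℕ × ℕ)) : Prop :=
  ∀ D' : Finset (ℕ × ℕ), IsPipeDream a b D' → IsReducedPD a b D' →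
    pdPerm a b D' = pdPerm a b D → D' = D


abbrev PDBox := ℕ × ℕ

lemma st_val (n k : ℕ) (hk : k + 1 < n) (x : Fin n) :
    (simpleTransposition n k x).val =
      if x.val = k then k + 1 else if x.val = k + 1 then k else x.val := by
  unfold simpleTransposition
  rw [dif_pos hk, Equiv.swap_apply_def]
  simp only [Fin.ext_iff]
  split_ifs <;> rfl

lemma st_one (n k : ℕ) (hk : ¬ k + 1 < n) : simpleTransposition n k = 1 := by
  unfold simpleTransposition
  rw [dif_neg hk]

lemma st_sq (n k : ℕ) : simpleTransposition n k * simpleTransposition n k = 1 := by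
  unfold simpleTransposition
  split_ifs
  · exact Equiv.swap_mul_self _ _
  · simp

lemma st_sq' (n k : ℕ) (w : Equiv.Perm (Fin n)) :
    simpleTransposition n k * (simpleTransposition n k * w) = w := by
  rw [← mul_assoc, st_sq, one_mul]

lemma st_inv (n k : ℕ) : (simpleTransposition n k)⁻¹ = simpleTransposition n k :=
  inv_eq_of_mul_eq_one_left (st_sq n k)

lemma st_app (n k : ℕ) (x : Fin n) :
    simpleTransposition n k (simpleTransposition n k x) = x := by
  rw [← Equiv.Perm.mul_apply, st_sq]; rfl

/-- ascent increases length -/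
lemma inv_asc (n k : ℕ) (hk : k + 1 < n) (w : Equiv.Perm (Fin n))
    (h : w⁻¹ ⟨k, by omega⟩ < w⁻¹ ⟨k + 1, hk⟩) :
    invCount (simpleTransposition n k * w) = invCount w + 1 := by
  unfold invCount
  rw [← Finset.card_insert_of_notMem
    (a := (w⁻¹ ⟨k, by omega⟩, w⁻¹ ⟨k + 1, hk⟩))]
  · congr 1
    ext ⟨x, y⟩
    rw [Finset.mem_insert, Finset.mem_filter, Finset.mem_filter, Prod.mk.injEq]
    simp only [Finset.mem_univ, true_and, Equiv.Perm.mul_apply]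
    have e1 : x = w⁻¹ ⟨k, by omega⟩ ↔ (w x).val = k := by
      rw [Equiv.Perm.eq_inv_iff_eq, Fin.ext_iff]
    have e2 : y = w⁻¹ ⟨k+1, by omega⟩ ↔ (w y).val = k+1 := by
      rw [Equiv.Perm.eq_inv_iff_eq, Fin.ext_iff]
    have e3 : x = w⁻¹ ⟨k+1, by omega⟩ ↔ (w x).val = k+1 := by
      rw [Equiv.Perm.eq_inv_iff_eq, Fin.ext_iff]
    have e4 : y = w⁻¹ ⟨k, by omega⟩ ↔ (w y).val = k := by
      rw [Equiv.Perm.eq_inv_iff_eq, Fin.ext_iff]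
    rw [Fin.lt_def (a := simpleTransposition n k (w y)), st_val n k hk, st_val n k hk,
      Fin.lt_def (a := w y)]
    by_cases hx : (w x).val = k
    · by_cases hy : (w y).val = k + 1
      · have hxy : x < y := by rw [e1.2 hx, e2.2 hy]; exact h
        rw [e1, e2]
        have hk' : k + 1 ≠ k := by omega
        simp only [hx, hy, hxy, if_true, if_neg hk']
        simp
      · rw [e1, e2]
        have := e4
        split_ifs <;> omega
    · by_cases hx' : (w x).val = k + 1
      · by_cases hy : (w y).val = k
        · have hxy : y < x := by rw [e3.2 hx', e4.2 hy]; exact h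
          have : ¬ x < y := not_lt.2 hxy.le
          simp only [this, false_and, or_false, e1, e2]
          simp [hx]
        · rw [e1, e2]; split_ifs <;> omega
      · rw [e1, e2]; split_ifs <;> omega
  · rw [Finset.mem_filter]
    rintro ⟨-, -, hh⟩
    simp [Fin.lt_def] at hh

lemma inv_one_pd (n : ℕ) : invCount (1 : Equiv.Perm (Fin n)) = 0 := by
  unfold invCount
  rw [Finset.card_eq_zero, Finset.filter_eq_empty_iff]
  rintro ⟨x, y⟩ _ ⟨h1, h2⟩
  exact absurd h1 (not_lt.2 (le_of_lt h2))

lemma inv_desc (n k : ℕ) (hk : k + 1 < n) (w : Equiv.Perm (Fin n))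
    (h : w⁻¹ ⟨k + 1, hk⟩ < w⁻¹ ⟨k, by omega⟩) :
    invCount (simpleTransposition n k * w) + 1 = invCount w := by
  have a1 : simpleTransposition n k ⟨k, by omega⟩ = ⟨k + 1, hk⟩ := by
    ext; rw [st_val n k hk]; simp
  have a2 : simpleTransposition n k ⟨k + 1, hk⟩ = ⟨k, by omega⟩ := by
    ext; rw [st_val n k hk]; simp
  have := inv_asc n k hk (simpleTransposition n k * w)
    (by simpa [mul_inv_rev, st_inv, a1, a2] using h)
  rw [st_sq'] at this
  exact this.symm

lemma inv_tri (n k : ℕ) (w : Equiv.Perm (Fin n)) :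
    invCount (simpleTransposition n k * w) ≤ invCount w ∨
    (∃ hk : k + 1 < n, (w⁻¹ ⟨k, by omega⟩ < w⁻¹ ⟨k + 1, hk⟩) ∧
      invCount (simpleTransposition n k * w) = invCount w + 1) := by
  by_cases hk : k + 1 < n
  · rcases lt_trichotomy (w⁻¹ ⟨k, by omega⟩) (w⁻¹ ⟨k + 1, hk⟩) with h | h | h
    · exact Or.inr ⟨hk, h, inv_asc n k hk w h⟩
    · simp at h
    · have := inv_desc n k hk w h
      left; omega
  · rw [st_one n k hk]; simp

/-- product of the crosses along a list of boxes -/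
def PP (n : ℕ) (D : Finset PDBox) : List PDBox → Equiv.Perm (Fin n)
  | [] => 1
  | x :: Q => (if x ∈ D then simpleTransposition n (x.1 + x.2 - 2) else 1) * PP n D Q

def cnt (D : Finset PDBox) (Q : List PDBox) : ℕ := (Q.filter (· ∈ D)).length

lemma cnt_cons (D : Finset PDBox) (x : PDBox) (Q : List PDBox) :
    cnt D (x :: Q) = (if x ∈ D then 1 else 0) + cnt D Q := by
  unfold cnt
  rw [List.filter_cons]
  split_ifs <;> simp_all [add_comm]

lemma PP_append (n : ℕ) (D : Finset PDBox) (Q Q' : List PDBox) :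
    PP n D (Q ++ Q') = PP n D Q * PP n D Q' := by
  induction Q with
  | nil => simp [PP]
  | cons x Q ih => simp only [List.cons_append, PP, ih, mul_assoc]

lemma PP_congr (n : ℕ) (D D' : Finset PDBox) (Q : List PDBox)
    (h : ∀ x ∈ Q, x ∈ D ↔ x ∈ D') : PP n D Q = PP n D' Q := by
  induction Q with
  | nil => rfl
  | cons x Q ih =>
    simp only [PP]
    rw [ih (fun y hy => h y (List.mem_cons_of_mem _ hy))]
    simp only [h x List.mem_cons_self]

lemma cnt_congr (D D' : Finset PDBox) (Q : List PDBox)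
    (h : ∀ x ∈ Q, x ∈ D ↔ x ∈ D') : cnt D Q = cnt D' Q := by
  induction Q with
  | nil => rfl
  | cons x Q ih =>
    rw [cnt_cons, cnt_cons, ih (fun y hy => h y (List.mem_cons_of_mem _ hy))]
    simp only [h x List.mem_cons_self]

lemma cnt_erase (D : Finset PDBox) (Q : List PDBox) (hQ : Q.Nodup) (q : PDBox)
    (hq : q ∈ Q) (hD : q ∈ D) : cnt (D.erase q) Q + 1 = cnt D Q := by
  induction Q with
  | nil => simp at hq
  | cons x Q ih =>
    rw [cnt_cons, cnt_cons]
    rw [List.nodup_cons] at hQ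
    by_cases hx : x = q
    · subst hx
      rw [cnt_congr (D.erase x) D Q]
      · simp [hD]; omega
      · intro y hy
        have : y ≠ x := fun h => hQ.1 (h ▸ hy)
        simp [this]
    · have h1 : q ∈ Q := by
        rcases List.mem_cons.1 hq with h | h
        · exact absurd h.symm hx
        · exact h
      have := ih hQ.2 h1
      have e : (x ∈ D.erase q) ↔ x ∈ D := by simp [hx]
      simp only [e]
      omega

lemma PP_le (n : ℕ) (D : Finset PDBox) (Q : List PDBox) :
    invCount (PP n D Q) ≤ cnt D Q := by
  induction Q with
  | nil => simp [PP, inv_one_pd]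
  | cons x Q ih =>
    rw [cnt_cons]
    simp only [PP]
    split_ifs
    · rcases inv_tri n (x.1 + x.2 - 2) (PP n D Q) with h | ⟨_, _, h⟩ <;> omega
    · rw [one_mul]; omega

/-- strong exchange -/
lemma exchange (n : ℕ) (D : Finset PDBox) (Q : List PDBox) (hQ : Q.Nodup) :
    ∀ (x y : Fin n), x < y → (PP n D Q)⁻¹ y < (PP n D Q)⁻¹ x →
    ∃ q ∈ Q, q ∈ D ∧ PP n (D.erase q) Q = Equiv.swap x y * PP n D Q := by
  induction Q with
  | nil =>
    intro x y h h'
    simp [PP] at h'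
    exact absurd h (not_lt.2 h'.le)
  | cons z Q ih =>
    intro x y h h'
    rw [List.nodup_cons] at hQ
    simp only [PP] at h' ⊢
    by_cases hz : z ∈ D
    · rw [if_pos hz] at h' ⊢
      set k := z.1 + z.2 - 2 with hk
      have key : Equiv.swap x y = simpleTransposition n k ∨
          simpleTransposition n k x < simpleTransposition n k y := by
        by_cases hkn : k + 1 < n
        · by_cases hxy : x.val = k ∧ y.val = k + 1
          · left
            unfold simpleTransposition
            rw [dif_pos hkn]
            congr 1 <;> ext <;> simp [hxy]
          · right
            rw [Fin.lt_def, st_val n k hkn, st_val n k hkn]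
            rw [Fin.lt_def] at h
            split_ifs <;> omega
        · right
          rw [st_one n k hkn]; exact h
      rcases key with key | key
      · refine ⟨z, List.mem_cons_self, hz, ?_⟩
        rw [if_neg (by simp), key, st_sq', one_mul]
        apply PP_congr
        intro u hu
        have : u ≠ z := fun e => hQ.1 (e ▸ hu)
        simp [this]
      · obtain ⟨q, hq, hqD, e⟩ := ih hQ.2 _ _ key
          (by simpa [mul_inv_rev, st_inv] using h')
        refine ⟨q, List.mem_cons_of_mem _ hq, hqD, ?_⟩
        have hne : z ≠ q := fun e => hQ.1 (e ▸ hq)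
        rw [if_pos (by simp [hne, hz]), e, Equiv.swap_apply_apply, st_inv]
        simp only [← mul_assoc, st_sq, one_mul]
    · rw [if_neg hz, one_mul] at h'
      obtain ⟨q, hq, hqD, e⟩ := ih hQ.2 x y h h'
      refine ⟨q, List.mem_cons_of_mem _ hq, hqD, ?_⟩
      rw [if_neg (by simp [hz]), if_neg hz, e]; simp

lemma red_cons (n : ℕ) (D : Finset PDBox) (Q : List PDBox) (x : PDBox) (hx : x ∈ D)
    (h : invCount (PP n D (x :: Q)) = cnt D (x :: Q)) :
    invCount (PP n D Q) = cnt D Q ∧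
    ∃ hk : x.1 + x.2 - 2 + 1 < n,
      (PP n D (x :: Q))⁻¹ ⟨x.1 + x.2 - 2 + 1, hk⟩ < (PP n D (x :: Q))⁻¹ ⟨x.1 + x.2 - 2, by omega⟩ := by
  rw [cnt_cons, if_pos hx] at h
  have hle := PP_le n D Q
  simp only [PP, if_pos hx] at h ⊢
  rcases inv_tri n (x.1 + x.2 - 2) (PP n D Q) with h1 | ⟨hk, h2, h1⟩
  · omega
  · refine ⟨by omega, hk, ?_⟩
    have a1 : simpleTransposition n (x.1 + x.2 - 2) ⟨x.1 + x.2 - 2, by omega⟩ = ⟨_, hk⟩ := by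
      ext; rw [st_val n _ hk]; simp
    have a2 : simpleTransposition n (x.1 + x.2 - 2) ⟨_, hk⟩ = ⟨x.1 + x.2 - 2, by omega⟩ := by
      ext; rw [st_val n _ hk]; simp
    simpa [mul_inv_rev, st_inv, a1, a2] using h2

lemma st_eq_swap (n k : ℕ) (hk : k + 1 < n) :
    simpleTransposition n k = Equiv.swap ⟨k, by omega⟩ ⟨k+1, hk⟩ := by
  unfold simpleTransposition
  rw [dif_pos hk]

lemma flip_exists (n : ℕ) (D : Finset PDBox) (Q : List PDBox) (hQ : Q.Nodup) :
    ∀ D' : Finset PDBox, invCount (PP n D Q) = cnt D Q → invCount (PP n D' Q) = cnt D' Q →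
    PP n D' Q = PP n D Q → (∃ z ∈ Q, ¬ (z ∈ D ↔ z ∈ D')) →
    ∃ p ∈ Q, ∃ q ∈ Q, p ∈ D ∧ q ∉ D ∧ PP n (insert q (D.erase p)) Q = PP n D Q := by
  induction Q with
  | nil => rintro D' - - - ⟨z, hz, -⟩; simp at hz
  | cons x Q ih =>
    intro D' h h' e hz
    rw [List.nodup_cons] at hQ
    have lift : (∃ p ∈ Q, ∃ q ∈ Q, p ∈ D ∧ q ∉ D ∧ PP n (insert q (D.erase p)) Q = PP n D Q) →
      ∃ p ∈ x :: Q, ∃ q ∈ x :: Q, p ∈ D ∧ q ∉ D ∧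
        PP n (insert q (D.erase p)) (x :: Q) = PP n D (x :: Q) := by
      rintro ⟨p, hp, q, hq, hpD, hqD, e⟩
      refine ⟨p, List.mem_cons_of_mem _ hp, q, List.mem_cons_of_mem _ hq, hpD, hqD, ?_⟩
      have h1 : x ≠ p := fun e => hQ.1 (e ▸ hp)
      have h2 : x ≠ q := fun e => hQ.1 (e ▸ hq)
      simp only [PP, e]
      simp [h1, h2]
    by_cases hx : x ∈ D <;> by_cases hx' : x ∈ D'
    · apply lift
      apply ih hQ.2 D' (red_cons n D Q x hx h).1 (red_cons n D' Q x hx' h').1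
      · simpa [PP, hx, hx'] using e
      · obtain ⟨z, hz, hn⟩ := hz
        rcases List.mem_cons.1 hz with rfl | hz
        · exact absurd (by simp [hx, hx']) hn
        · exact ⟨z, hz, hn⟩
    · obtain ⟨r, hk, hlt⟩ := red_cons n D Q x hx h
      rw [← e] at hlt
      have e0 : PP n D' (x :: Q) = PP n D' Q := by simp [PP, hx']
      rw [e0] at hlt
      obtain ⟨q, hq, hqD, e2⟩ := exchange n D' Q hQ.2 _ _ (by simp [Fin.lt_def]) hlt
      have hxq : x ≠ q := fun e => hQ.1 (e ▸ hq)
      rw [← st_eq_swap] at e2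
      have e3 : PP n (D'.erase q) Q = PP n D Q := by
        rw [e2, ← e0, e]
        simp only [PP, if_pos hx, st_sq']
      by_cases hag : ∃ z ∈ Q, ¬ (z ∈ D ↔ z ∈ D'.erase q)
      · apply lift
        refine ih hQ.2 (D'.erase q) r ?_ e3 hag
        rw [e3]
        have c1 := cnt_erase D' Q hQ.2 q hq hqD
        rw [cnt_cons, if_neg hx', e, h, cnt_cons, if_pos hx] at h'
        omega
      · push Not at hag
        have hqD' : q ∉ D := fun hc => by
          have := (hag q hq).1 hc
          simp at this
        refine ⟨x, List.mem_cons_self, q, List.mem_cons_of_mem _ hq, hx, hqD', ?_⟩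
        rw [← e, e0]
        simp only [PP]
        rw [if_neg (by simp [hxq]), one_mul]
        apply PP_congr
        intro z hz
        have hzx : z ≠ x := fun e => hQ.1 (e ▸ hz)
        have := hag z hz
        by_cases hzq : z = q
        · subst hzq; simp [hqD]
        · simp [hzx, hzq, this]
    · obtain ⟨r, hk, hlt⟩ := red_cons n D' Q x hx' h'
      rw [e] at hlt
      have e0 : PP n D (x :: Q) = PP n D Q := by simp [PP, hx]
      rw [e0] at hlt
      obtain ⟨p, hp, hpD, e2⟩ := exchange n D Q hQ.2 _ _ (by simp [Fin.lt_def]) hlt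
      rw [← st_eq_swap] at e2
      refine ⟨p, List.mem_cons_of_mem _ hp, x, List.mem_cons_self, hpD, hx, ?_⟩
      rw [e0]
      simp only [PP]
      rw [if_pos (by simp)]
      rw [PP_congr n (insert x (D.erase p)) (D.erase p) Q, e2, st_sq']
      intro z hz
      have hzx : z ≠ x := fun e => hQ.1 (e ▸ hz)
      simp [hzx]
    · apply lift
      rw [cnt_cons, if_neg hx] at h
      rw [cnt_cons, if_neg hx'] at h'
      simp only [PP, if_neg hx, if_neg hx', one_mul, zero_add] at h h' e
      apply ih hQ.2 D' h h' e
      obtain ⟨z, hz, hn⟩ := hz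
      rcases List.mem_cons.1 hz with rfl | hz
      · exact absurd (by simp [hx, hx']) hn
      · exact ⟨z, hz, hn⟩

def nxt (b : ℕ) (x y : PDBox) : Prop :=
  (y.1 = x.1 ∧ y.2 = x.2 + 1) ∨ (x.1 = y.1 + 1 ∧ x.2 = b ∧ y.2 = 1)

def bef (x y : PDBox) : Prop := y.1 < x.1 ∨ (y.1 = x.1 ∧ x.2 < y.2)

def boxes (a b : ℕ) : List PDBox :=
  (List.range a).reverse.flatMap fun r => (List.range b).map fun c => (r + 1, c + 1)

lemma mem_boxes (a b : ℕ) (x : PDBox) :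
    x ∈ boxes a b ↔ 1 ≤ x.1 ∧ x.1 ≤ a ∧ 1 ≤ x.2 ∧ x.2 ≤ b := by
  obtain ⟨i, j⟩ := x
  simp only [boxes, List.mem_flatMap, List.mem_reverse, List.mem_range, List.mem_map,
    Prod.mk.injEq]
  constructor
  · rintro ⟨r, hr, c, hc, rfl, rfl⟩; omega
  · rintro ⟨h1, h2, h3, h4⟩
    exact ⟨i - 1, by omega, j - 1, by omega, by omega, by omega⟩

lemma boxes_succ (a b : ℕ) :
    boxes (a + 1) b = ((List.range b).map fun c => (a + 1, c + 1)) ++ boxes a b := by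
  simp [boxes, List.range_succ]

lemma row_chain (a b m : ℕ) :
    List.IsChain (nxt b) ((List.range m).map fun c => ((a + 1, c + 1) : PDBox)) := by
  induction m with
  | zero => simp
  | succ m ih =>
    rw [List.range_succ, List.map_append, List.isChain_append]
    refine ⟨ih, by simp, ?_⟩
    intro x hx y hy
    cases m with
    | zero => simp at hx
    | succ m =>
      simp [List.range_succ] at hx hy
      subst hx; subst hy
      left; simp

lemma boxes_chain (a b : ℕ) : List.IsChain (nxt b) (boxes a b) := by
  induction a with
  | zero => simp [boxes]
  | succ a ih =>
    rw [boxes_succ, List.isChain_append]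
    refine ⟨row_chain a b b, ih, ?_⟩
    intro x hx y hy
    cases b with
    | zero => simp at hx
    | succ b =>
      cases a with
      | zero => simp [boxes] at hy
      | succ a =>
        rw [boxes_succ] at hy
        rw [List.range_succ_eq_map] at hy
        simp at hy
        simp [List.range_succ] at hx
        subst hx; subst hy
        right; simp

lemma boxes_sorted (a b : ℕ) : (boxes a b).Pairwise bef := by
  induction a with
  | zero => simp [boxes]
  | succ a ih =>
    rw [boxes_succ, List.pairwise_append]
    refine ⟨?_, ih, ?_⟩
    · rw [List.pairwise_map]
      apply List.pairwise_lt_range.imp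
      intro x y h
      right; simpa using h
    · intro x hx y hy
      rw [mem_boxes] at hy
      simp only [List.mem_map, List.mem_range] at hx
      obtain ⟨c, _, rfl⟩ := hx
      left; simp; omega

lemma boxes_nodup (a b : ℕ) : (boxes a b).Nodup :=
  (boxes_sorted a b).imp (fun {x y} h e => by subst e; rcases h with h | h <;> omega)

lemma pdPerm_eq (a b : ℕ) (D : Finset PDBox) : pdPerm a b D = PP (a + b) D (boxes a b) := by
  have row : ∀ (r : ℕ) (L : List ℕ),
      ((L.filterMap fun c => if (r + 1, c + 1) ∈ D then some (r + c) else none).map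
        (simpleTransposition (a + b))).prod =
      PP (a + b) D (L.map fun c => (r + 1, c + 1)) := by
    intro r L
    induction L with
    | nil => simp [PP]
    | cons c L ih =>
      simp only [List.map_cons, PP]
      rw [← ih]
      by_cases h : (r + 1, c + 1) ∈ D
      · have : r + 1 + (c + 1) - 2 = r + c := by omega
        simp [h, this]
      · simp [h]
  unfold pdPerm readingWord boxes
  induction (List.range a).reverse with
  | nil => simp [PP]
  | cons r L ih =>
    simp only [List.flatMap_cons, List.map_append, List.prod_append, PP_append]
    rw [ih, row]

lemma card_eq_cnt (a b : ℕ) (D : Finset PDBox) (h : IsPipeDream a b D) :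
    D.card = cnt D (boxes a b) := by
  unfold cnt
  rw [← List.toFinset_card_of_nodup ((boxes_nodup a b).filter _)]
  congr 1
  ext x
  simp only [List.mem_toFinset, List.mem_filter, mem_boxes, decide_eq_true_eq]
  constructor
  · intro hx
    have := h hx
    simp only [Finset.mem_product, Finset.mem_Icc] at this
    exact ⟨by omega, hx⟩
  · exact fun hx => hx.2

lemma mem_pd (a b : ℕ) (D : Finset PDBox) : IsPipeDream a b D ↔ ∀ x ∈ D, x ∈ boxes a b := by
  unfold IsPipeDream
  constructor
  · intro h x hx
    have := h hx
    simp only [Finset.mem_product, Finset.mem_Icc] at this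
    rw [mem_boxes]; omega
  · intro h x hx
    have := h x hx
    rw [mem_boxes] at this
    simp only [Finset.mem_product, Finset.mem_Icc]
    omega

/-- split the list of boxes at two boxes -/
lemma split_boxes (a b : ℕ) (p q : PDBox) (hp : p ∈ boxes a b) (hq : q ∈ boxes a b)
    (h : bef p q) : ∃ Q1 Q2 Q3, boxes a b = Q1 ++ p :: (Q2 ++ q :: Q3) ∧
      (∀ x ∈ Q1, x ≠ p ∧ x ≠ q) ∧ (∀ x ∈ Q3, x ≠ p ∧ x ≠ q) ∧
      (∀ x ∈ Q2, x ∈ boxes a b ∧ bef p x ∧ bef x q) ∧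
      List.IsChain (nxt b) (p :: (Q2 ++ [q])) := by
  obtain ⟨Q1, R, e⟩ := List.append_of_mem hp
  have irr : ∀ x, ¬ bef x x := by
    intro x h; rcases h with h | h <;> omega
  have asy : ∀ x y, bef x y → ¬ bef y x := by
    intro x y h h'; unfold bef at *; omega
  have hs := boxes_sorted a b
  rw [e] at hs
  have hqR : q ∈ R := by
    rw [e] at hq
    rw [List.pairwise_append] at hs
    rcases List.mem_append.1 hq with h1 | h1
    · exact absurd h (asy _ _ (hs.2.2 q h1 p List.mem_cons_self))
    · rcases List.mem_cons.1 h1 with rfl | h1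
      · exact absurd h (irr _)
      · exact h1
  obtain ⟨Q2, Q3, rfl⟩ := List.append_of_mem hqR
  refine ⟨Q1, Q2, Q3, e, ?_⟩
  have hc := boxes_chain a b
  rw [e] at hc
  simp only [List.pairwise_append, List.pairwise_cons, List.mem_append, List.mem_cons] at hs
  obtain ⟨s1, ⟨s2, s3, ⟨s4, s5⟩, s6⟩, s7⟩ := hs
  refine ⟨fun x hx => ⟨?_, ?_⟩, fun x hx => ⟨?_, ?_⟩, fun x hx => ⟨?_, ?_, ?_⟩, ?_⟩
  · rintro rfl; exact irr _ (s7 x hx x (by simp))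
  · rintro rfl; exact irr _ (s7 x hx x (by simp))
  · rintro rfl; exact irr _ (s2 x (by simp [hx]))
  · rintro rfl; exact irr _ (s4 x hx)
  · rw [e]; simp [hx]
  · exact s2 x (by simp [hx])
  · exact s6 x hx q (by simp)
  · have e2 : Q1 ++ p :: (Q2 ++ q :: Q3) = Q1 ++ ((p :: (Q2 ++ [q])) ++ Q3) := by simp
    rw [e2] at hc
    exact (List.isChain_append.1 (List.isChain_append.1 hc).2.1).1

/-- one step of following a wire -/
def act (D : Finset PDBox) (z : PDBox) (x : ℕ) : ℕ :=
  if z ∈ D then (if x = z.1 + z.2 then z.1 + z.2 + 1 else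
    if x = z.1 + z.2 + 1 then z.1 + z.2 else x) else x

lemma trace_wire (a b : ℕ) (D : Finset PDBox) (st : PDBox → ℕ) (q : PDBox) (L : List PDBox) :
    ∀ (p : PDBox) (x : ℕ),
    List.IsChain (nxt b) (p :: (L ++ [q])) →
    (∀ u ∈ L, u ∈ boxes a b) →
    (∀ u ∈ L, ∀ v, nxt b u v → act D u (st u) = st v) →
    (∀ v, nxt b p v → st v = x) →
    ∀ y : Fin (a + b), y.val + 2 = st q → (PP (a + b) D L y).val + 2 = x := by
  induction L with
  | nil =>
    intro p x hc _ _ hx y hy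
    simp at hc
    simp [PP, hy, hx q hc]
  | cons z L ih =>
    intro p x hc hL hst hx y hy
    simp only [List.cons_append, List.isChain_cons_cons] at hc
    have hz := hx z hc.1
    have h := ih z (act D z x) hc.2 (fun u hu => hL u (List.mem_cons_of_mem _ hu))
      (fun u hu => hst u (List.mem_cons_of_mem _ hu))
      (fun v hv => by rw [← hst z List.mem_cons_self v hv, hz]) y hy
    have hb := (mem_boxes a b z).1 (hL z List.mem_cons_self)
    simp only [PP, Equiv.Perm.mul_apply]
    unfold act at h
    split_ifs with hD
    · rw [if_pos hD] at h
      rw [st_val _ _ (by omega)]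
      split_ifs at h ⊢ <;> omega
    · rw [if_neg hD] at h
      simpa using h

lemma conj_of_vals (n k l : ℕ) (hk : k + 1 < n) (hl : l + 1 < n) (u : Equiv.Perm (Fin n))
    (h1 : ∀ y : Fin n, y.val = l → (u y).val = k)
    (h2 : ∀ y : Fin n, y.val = l + 1 → (u y).val = k + 1) :
    simpleTransposition n k * u = u * simpleTransposition n l := by
  rw [st_eq_swap n k hk, st_eq_swap n l hl, Equiv.mul_swap_eq_swap_mul]
  congr 2
  · ext; rw [h1 _ rfl]
  · ext; rw [h2 _ rfl]

lemma vals_of_conj (n k l : ℕ) (hk : k + 1 < n) (hl : l + 1 < n) (u : Equiv.Perm (Fin n))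
    (h : simpleTransposition n k * u = u * simpleTransposition n l) (y : Fin n) :
    ((u y).val = k ∨ (u y).val = k + 1) ↔ (y.val = l ∨ y.val = l + 1) := by
  have e : simpleTransposition n k (u y) = u (simpleTransposition n l y) := by
    rw [← Equiv.Perm.mul_apply, h, Equiv.Perm.mul_apply]
  have fix : ∀ m (hm : m + 1 < n) (z : Fin n),
      (z.val = m ∨ z.val = m + 1) ↔ simpleTransposition n m z ≠ z := by
    intro m hm z
    rw [Ne, Fin.ext_iff, st_val n m hm]
    split_ifs <;> omega
  rw [fix k hk, fix l hl, e]
  simp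

lemma PP_split (n : ℕ) (D : Finset PDBox) (Q1 Q2 Q3 : List PDBox) (p q : PDBox) :
    PP n D (Q1 ++ p :: (Q2 ++ q :: Q3)) =
      PP n D Q1 * ((if p ∈ D then simpleTransposition n (p.1 + p.2 - 2) else 1) * PP n D Q2 *
        (if q ∈ D then simpleTransposition n (q.1 + q.2 - 2) else 1)) * PP n D Q3 := by
  simp only [PP_append, PP, mul_assoc]

set_option maxHeartbeats 4000000 in
lemma rect_conj (a b : ℕ) (D : Finset PDBox) (i1 i2 j1 j2 : ℕ) (hi : i1 < i2) (hj : j1 < j2)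
    (hi1 : 1 ≤ i1) (hi2 : i2 ≤ a) (hj1 : 1 ≤ j1) (hj2 : j2 ≤ b)
    (e1 : (i1, j1) ∉ D) (e2 : (i2, j2) ∉ D)
    (hc : ∀ u v, i1 ≤ u → u ≤ i2 → j1 ≤ v → v ≤ j2 → ¬ (u = i1 ∧ v = j1) → ¬ (u = i2 ∧ v = j2) →
      ¬ (u = i2 ∧ v = j1) → ¬ (u = i1 ∧ v = j2) → (u, v) ∈ D)
    (Q2 : List PDBox)
    (h2 : ∀ x ∈ Q2, x ∈ boxes a b ∧ bef (i2, j1) x ∧ bef x (i1, j2))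
    (hch : List.IsChain (nxt b) ((i2, j1) :: (Q2 ++ [(i1, j2)]))) :
    simpleTransposition (a + b) (i2 + j1 - 2) * PP (a + b) D Q2 =
      PP (a + b) D Q2 * simpleTransposition (a + b) (i1 + j2 - 2) := by
  have facts : ∀ u v, (u, v) ∈ Q2 → 1 ≤ u ∧ u ≤ a ∧ 1 ≤ v ∧ v ≤ b ∧
      (u < i2 ∨ (u = i2 ∧ j1 < v)) ∧ (i1 < u ∨ (i1 = u ∧ v < j2)) := by
    intro u v h
    obtain ⟨h, h', h''⟩ := h2 _ h
    rw [mem_boxes] at h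
    simp only [bef] at h h' h''
    omega
  have elb : ∀ u v, (u, v) ∈ D → ¬ (u = i1 ∧ v = j1) ∧ ¬ (u = i2 ∧ v = j2) := by
    intro u v h
    refine ⟨?_, ?_⟩
    · rintro ⟨rfl, rfl⟩; exact e1 h
    · rintro ⟨rfl, rfl⟩; exact e2 h
  apply conj_of_vals _ _ _ (by omega) (by omega)
  · intro y hy
    have tr := fun H1 H2 H3 => trace_wire a b D (fun z => if z.1 = i1 then
      (if z.2 ≤ j1 then i1 + j1 + 1 else i1 + z.2) else
      (if z.2 ≤ j1 then z.1 + j1 + 1 else z.1 + j1)) (i1, j2) Q2 (i2, j1) (i2 + j1) hch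
      (fun u hu => (h2 u hu).1) H1 H2 y H3
    have tr := tr ?_ ?_ ?_
    · omega
    · rintro ⟨u, v⟩ huv ⟨u', v'⟩ hn
      have f := facts u v huv
      have g := elb u v
      have g' := hc u v
      simp only [nxt] at hn
      simp only [act]
      clear hc elb facts h2 hch tr hy y
      by_cases hD : (u, v) ∈ D
      · have g := g hD
        simp only [hD, if_true]
        clear g'
        rcases hn with ⟨hn1, hn2⟩ | ⟨hn1, hn2, hn3⟩ <;> split_ifs <;> omega
      · simp only [hD, if_false]
        have g' : ¬ (i1 ≤ u ∧ u ≤ i2 ∧ j1 ≤ v ∧ v ≤ j2 ∧ ¬ (u = i1 ∧ v = j1) ∧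
          ¬ (u = i2 ∧ v = j2)) := by
          rintro ⟨a1, a2, a3, a4, a5, a6⟩
          exact hD (g' a1 a2 a3 a4 a5 a6 (by omega) (by omega))
        clear g
        rcases hn with ⟨hn1, hn2⟩ | ⟨hn1, hn2, hn3⟩ <;> split_ifs <;> omega
    · rintro ⟨u', v'⟩ hn
      simp only [nxt] at hn ⊢
      split_ifs <;> omega
    · simp only [hy]
      split_ifs <;> omega
  · intro y hy
    have tr := fun H1 H2 H3 => trace_wire a b D (fun z => if z.1 = i2 then
      (if z.2 ≤ j2 then i2 + z.2 else i2 + j2) else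
      (if z.2 ≤ j2 then z.1 + j2 + 1 else z.1 + j2)) (i1, j2) Q2 (i2, j1) (i2 + j1 + 1) hch
      (fun u hu => (h2 u hu).1) H1 H2 y H3
    have tr := tr ?_ ?_ ?_
    · omega
    · rintro ⟨u, v⟩ huv ⟨u', v'⟩ hn
      have f := facts u v huv
      have g := elb u v
      have g' := hc u v
      simp only [nxt] at hn
      simp only [act]
      clear hc elb facts h2 hch tr hy y
      by_cases hD : (u, v) ∈ D
      · have g := g hD
        simp only [hD, if_true]
        clear g'
        rcases hn with ⟨hn1, hn2⟩ | ⟨hn1, hn2, hn3⟩ <;> split_ifs <;> omega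
      · simp only [hD, if_false]
        have g' : ¬ (i1 ≤ u ∧ u ≤ i2 ∧ j1 ≤ v ∧ v ≤ j2 ∧ ¬ (u = i1 ∧ v = j1) ∧
          ¬ (u = i2 ∧ v = j2)) := by
          rintro ⟨a1, a2, a3, a4, a5, a6⟩
          exact hD (g' a1 a2 a3 a4 a5 a6 (by omega) (by omega))
        clear g
        rcases hn with ⟨hn1, hn2⟩ | ⟨hn1, hn2, hn3⟩ <;> split_ifs <;> omega
    · rintro ⟨u', v'⟩ hn
      simp only [nxt] at hn ⊢
      split_ifs <;> omega
    · simp only [hy]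
      split_ifs <;> omega

/-- a rectangle move contradicts rigidity -/
lemma rect_move (a b : ℕ) (D : Finset PDBox) (hpd : IsPipeDream a b D)
    (hred : IsReducedPD a b D) (hrig : IsRigid a b D)
    (i1 i2 j1 j2 : ℕ) (hi : i1 < i2) (hj : j1 < j2)
    (hi1 : 1 ≤ i1) (hi2 : i2 ≤ a) (hj1 : 1 ≤ j1) (hj2 : j2 ≤ b)
    (e1 : (i1, j1) ∉ D) (e2 : (i2, j2) ∉ D)
    (hc : ∀ u v, i1 ≤ u → u ≤ i2 → j1 ≤ v → v ≤ j2 → ¬ (u = i1 ∧ v = j1) → ¬ (u = i2 ∧ v = j2) →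
      ¬ (u = i2 ∧ v = j1) → ¬ (u = i1 ∧ v = j2) → (u, v) ∈ D)
    (hcross : (i2, j1) ∈ D ∨ (i1, j2) ∈ D) : False := by
  have hpB : (i2, j1) ∈ boxes a b := by rw [mem_boxes]; simp only; omega
  have hqB : (i1, j2) ∈ boxes a b := by rw [mem_boxes]; simp only; omega
  obtain ⟨Q1, Q2, Q3, e, h1, h3, h2, hch⟩ := split_boxes a b (i2, j1) (i1, j2) hpB hqB
    (by left; exact hi)
  have conj := rect_conj a b D i1 i2 j1 j2 hi hj hi1 hi2 hj1 hj2 e1 e2 hc Q2 h2 hch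
  have hne : ((i2, j1) : PDBox) ≠ (i1, j2) := by
    intro h; rw [Prod.mk.injEq] at h; omega
  have n2 : ∀ x ∈ Q2, x ≠ (i2, j1) ∧ x ≠ (i1, j2) := by
    intro x hx
    obtain ⟨-, hb, hb'⟩ := h2 x hx
    constructor
    · rintro rfl; rcases hb with h | h <;> omega
    · rintro rfl; rcases hb' with h | h <;> omega
  have hred' := hred
  unfold IsReducedPD at hred'
  rw [pdPerm_eq, card_eq_cnt a b D hpd] at hred'
  generalize hp : ((i2, j1) : PDBox) = p at *
  generalize hq : ((i1, j2) : PDBox) = q at *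
  have ip : i2 + j1 - 2 = p.1 + p.2 - 2 := by rw [← hp]
  have iq : i1 + j2 - 2 = q.1 + q.2 - 2 := by rw [← hq]
  rw [ip, iq] at conj
  have cong : ∀ D' : Finset PDBox, (∀ x, x ≠ p → x ≠ q → (x ∈ D' ↔ x ∈ D)) →
      PP (a + b) D' Q1 = PP (a + b) D Q1 ∧ PP (a + b) D' Q2 = PP (a + b) D Q2 ∧
      PP (a + b) D' Q3 = PP (a + b) D Q3 := by
    intro D' h
    exact ⟨PP_congr _ _ _ _ fun x hx => h x (h1 x hx).1 (h1 x hx).2,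
      PP_congr _ _ _ _ fun x hx => h x (n2 x hx).1 (n2 x hx).2,
      PP_congr _ _ _ _ fun x hx => h x (h3 x hx).1 (h3 x hx).2⟩
  have swapcase : ∀ x y : PDBox, x ∈ D → y ∉ D → y ∈ boxes a b →
      pdPerm a b (insert y (D.erase x)) = pdPerm a b D → False := by
    intro x y hx hy hyB hperm
    have hpd' : IsPipeDream a b (insert y (D.erase x)) := by
      rw [mem_pd] at hpd ⊢
      intro z hz
      rcases Finset.mem_insert.1 hz with rfl | hz
      · exact hyB
      · exact hpd z (Finset.mem_of_mem_erase hz)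
    have := hrig (insert y (D.erase x)) hpd' (by
      unfold IsReducedPD at hred ⊢
      rw [hperm, hred, Finset.card_insert_of_notMem (by simp [hy]),
        Finset.card_erase_add_one hx]) hperm
    apply hy
    rw [← this]
    simp
  by_cases hpD : p ∈ D <;> by_cases hqD : q ∈ D
  · have hD' : ∀ x, x ≠ p → x ≠ q → (x ∈ (D.erase p).erase q ↔ x ∈ D) := by
      intro x hx hx'; simp [hx, hx']
    obtain ⟨c1, c2, c3⟩ := cong _ hD'
    have : PP (a + b) ((D.erase p).erase q) (boxes a b) = PP (a + b) D (boxes a b) := by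
      rw [e, PP_split, PP_split, c1, c2, c3, if_pos hpD, if_pos hqD, if_neg (by simp),
        if_neg (by simp), conj, mul_assoc (PP (a + b) D Q2), st_sq]
      simp
    have l1 := PP_le (a + b) ((D.erase p).erase q) (boxes a b)
    have l2 := cnt_erase D _ (boxes_nodup a b) p hpB hpD
    have l3 := cnt_erase (D.erase p) _ (boxes_nodup a b) q hqB (by simp [hqD, hne.symm])
    rw [this] at l1
    omega
  · apply swapcase p q hpD hqD hqB
    obtain ⟨c1, c2, c3⟩ := cong (insert q (D.erase p)) (by
      intro x hx hx'; simp [hx, hx'])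
    rw [pdPerm_eq, pdPerm_eq, e, PP_split, PP_split, c1, c2, c3, if_pos hpD, if_neg hqD,
      if_neg (by simp [hne]), if_pos (by simp), conj]
    simp
  · apply swapcase q p hqD hpD hpB
    obtain ⟨c1, c2, c3⟩ := cong (insert p (D.erase q)) (by
      intro x hx hx'; simp [hx, hx'])
    rw [pdPerm_eq, pdPerm_eq, e, PP_split, PP_split, c1, c2, c3, if_pos hqD, if_neg hpD,
      if_pos (by simp), if_neg (by simp [hne.symm]), conj]
    simp
  · rcases hcross with h | h
    · exact hpD h
    · exact hqD h

lemma no_NE (a b : ℕ) (D : Finset PDBox) (hpd : IsPipeDream a b D)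
    (hred : IsReducedPD a b D) (hrig : IsRigid a b D) (m : ℕ) :
    ∀ i j i' j', (i - i') + (j' - j) ≤ m → (i, j) ∈ D → 1 ≤ i' → i' < i → (i', j) ∉ D →
      j < j' → j' ≤ b → (i, j') ∉ D → False := by
  induction m with
  | zero => intros; omega
  | succ m ih =>
    intro i j i' j' hm h1 h2 h3 h4 h5 h6 h7
    have hB := (mem_boxes _ _ _).1 ((mem_pd a b D).1 hpd _ h1)
    simp only at hB
    refine rect_move a b D hpd hred hrig i' i j j' h3 h5 h2 (by omega) (by omega) h6 h4 h7 ?_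
      (Or.inl h1)
    intro u v u1 u2 v1 v2 n1 n2 n3 n4
    by_contra hn
    by_cases hu : u = i
    · subst hu
      exact ih u j i' v (by omega) h1 h2 h3 h4 (by omega) (by omega) hn
    by_cases hv : v = j
    · subst hv
      exact ih i v u j' (by omega) h1 (by omega) (by omega) hn h5 h6 h7
    by_cases hv' : v < j'
    · by_cases hx : (i, v) ∈ D
      · exact ih i v u j' (by omega) hx (by omega) (by omega) hn hv' h6 h7
      · exact ih i j i' v (by omega) h1 h2 h3 h4 (by omega) (by omega) hx
    · have hv'' : v = j' := by omega
      subst hv''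
      by_cases hx : (u, j) ∈ D
      · exact ih u j i' v (by omega) hx h2 (by omega) h4 h5 h6 hn
      · exact ih i j u v (by omega) h1 (by omega) (by omega) hx h5 h6 h7

lemma no_SW (a b : ℕ) (D : Finset PDBox) (hpd : IsPipeDream a b D)
    (hred : IsReducedPD a b D) (hrig : IsRigid a b D) (m : ℕ) :
    ∀ i j i' j', (i' - i) + (j - j') ≤ m → (i, j) ∈ D → i < i' → i' ≤ a → (i', j) ∉ D →
      1 ≤ j' → j' < j → (i, j') ∉ D → False := by
  induction m with
  | zero => intros; omega
  | succ m ih =>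
    intro i j i' j' hm h1 h2 h3 h4 h5 h6 h7
    have hB := (mem_boxes _ _ _).1 ((mem_pd a b D).1 hpd _ h1)
    simp only at hB
    refine rect_move a b D hpd hred hrig i i' j' j h2 h6 (by omega) h3 h5 (by omega) h7 h4 ?_
      (Or.inr h1)
    intro u v u1 u2 v1 v2 n1 n2 n3 n4
    by_contra hn
    by_cases hu : u = i
    · subst hu
      exact ih u j i' v (by omega) h1 h2 h3 h4 (by omega) (by omega) hn
    by_cases hv : v = j
    · subst hv
      exact ih i v u j' (by omega) h1 (by omega) (by omega) hn h5 h6 h7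
    by_cases hv' : j' < v
    · by_cases hx : (i, v) ∈ D
      · exact ih i v u j' (by omega) hx (by omega) (by omega) hn h5 hv' h7
      · exact ih i j i' v (by omega) h1 h2 h3 h4 (by omega) (by omega) hx
    · have hv'' : v = j' := by omega
      subst hv''
      by_cases hx : (u, j) ∈ D
      · exact ih u j i' v (by omega) hx (by omega) h3 h4 h5 h6 hn
      · exact ih i j u v (by omega) h1 (by omega) (by omega) hx h5 h6 h7

lemma flip_conj (n : ℕ) (D D' : Finset PDBox) (Q1 Q2 Q3 : List PDBox) (p q : PDBox)
    (h1 : ∀ x ∈ Q1, x ≠ p ∧ x ≠ q) (h3 : ∀ x ∈ Q3, x ≠ p ∧ x ≠ q)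
    (h2 : ∀ x ∈ Q2, x ≠ p ∧ x ≠ q) (hD : ∀ x, x ≠ p → x ≠ q → (x ∈ D' ↔ x ∈ D))
    (hp : p ∈ D) (hq : q ∉ D) (hp' : p ∉ D') (hq' : q ∈ D')
    (e : PP n D' (Q1 ++ p :: (Q2 ++ q :: Q3)) = PP n D (Q1 ++ p :: (Q2 ++ q :: Q3))) :
    simpleTransposition n (p.1 + p.2 - 2) * PP n D Q2 =
      PP n D Q2 * simpleTransposition n (q.1 + q.2 - 2) := by
  rw [PP_split, PP_split, if_pos hp, if_neg hq, if_neg hp', if_pos hq',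
    PP_congr n D' D Q1 fun x hx => hD x (h1 x hx).1 (h1 x hx).2,
    PP_congr n D' D Q2 fun x hx => hD x (h2 x hx).1 (h2 x hx).2,
    PP_congr n D' D Q3 fun x hx => hD x (h3 x hx).1 (h3 x hx).2] at e
  have := mul_left_cancel (mul_right_cancel e)
  simpa using this.symm

set_option maxHeartbeats 4000000 in
theorem rigid_of (a b : ℕ) (D : Finset PDBox)
    (hpd : IsPipeDream a b D) (hred : IsReducedPD a b D)
    (c1 : ¬ ∃ i j i' j' : ℕ, (i, j) ∈ D ∧
          1 ≤ i' ∧ i' < i ∧ (i', j) ∉ D ∧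
          j < j' ∧ j' ≤ b ∧ (i, j') ∉ D)
    (c2 : ¬ ∃ i j i' j' : ℕ, (i, j) ∈ D ∧
          i < i' ∧ i' ≤ a ∧ (i', j) ∉ D ∧
          1 ≤ j' ∧ j' < j ∧ (i, j') ∉ D) : IsRigid a b D := by
  intro D' hpd' hred' hperm
  by_contra hne
  unfold IsReducedPD at hred hred'
  rw [pdPerm_eq, card_eq_cnt a b _ hpd] at hred
  rw [pdPerm_eq, card_eq_cnt a b _ hpd'] at hred'
  rw [pdPerm_eq, pdPerm_eq] at hperm
  have hz : ∃ z ∈ boxes a b, ¬ (z ∈ D ↔ z ∈ D') := by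
    by_contra hc
    push Not at hc
    apply hne
    ext z
    constructor
    · intro h; exact (hc z ((mem_pd a b D').1 hpd' z h)).2 h
    · intro h; exact (hc z ((mem_pd a b D).1 hpd z h)).1 h
  obtain ⟨p, hpB, q, hqB, hp, hq, e⟩ :=
    flip_exists (a + b) D _ (boxes_nodup a b) D' hred hred' hperm hz
  have hpq : p ≠ q := fun h => hq (h ▸ hp)
  have hD : ∀ x, x ≠ p → x ≠ q → (x ∈ insert q (D.erase p) ↔ x ∈ D) := by
    intro x h h'; simp [h, h']
  have hp' : p ∉ insert q (D.erase p) := by simp [hpq]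
  have hq' : q ∈ insert q (D.erase p) := by simp
  have tot : bef p q ∨ bef q p := by
    by_contra hc
    apply hpq
    unfold bef at hc
    ext <;> omega
  obtain ⟨i, j⟩ := p
  obtain ⟨k, l⟩ := q
  have bp := (mem_boxes _ _ _).1 hpB
  have bq := (mem_boxes _ _ _).1 hqB
  simp only at bp bq
  rcases tot with hb | hb
  · obtain ⟨Q1, Q2, Q3, eQ, h1, h3, h2, hch⟩ := split_boxes a b _ _ hpB hqB hb
    have n2 : ∀ x ∈ Q2, x ≠ (i, j) ∧ x ≠ (k, l) := by
      intro x hx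
      obtain ⟨-, hb, hb'⟩ := h2 x hx
      constructor
      · rintro rfl; rcases hb with h | h <;> omega
      · rintro rfl; rcases hb' with h | h <;> omega
    rw [eQ] at e
    have conj := flip_conj _ D _ Q1 Q2 Q3 _ _ h1 h3 n2 hD hp hq hp' hq' e
    have vals := vals_of_conj _ _ _ (by simp only; omega) (by simp only; omega) _ conj
    simp only [bef] at hb
    have facts : ∀ u v, (u, v) ∈ Q2 → 1 ≤ u ∧ u ≤ a ∧ 1 ≤ v ∧ v ≤ b ∧
        (u < i ∨ (u = i ∧ j < v)) ∧ (k < u ∨ (k = u ∧ v < l)) := by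
      intro u v h
      obtain ⟨h, h', h''⟩ := h2 _ h
      rw [mem_boxes] at h
      simp only [bef] at h h' h''
      omega
    by_cases hN : ∀ u, 1 ≤ u → u < i → (u, j) ∈ D
    · have hkl : ¬ (k < i ∧ l = j) := by
        rintro ⟨h, rfl⟩; exact hq (hN k (by omega) h)
      have tr := trace_wire a b D (fun z => if z.2 ≤ j then z.1 + j + 1 else z.1 + j) (k, l)
        Q2 (i, j) (i + j) hch (fun u hu => (h2 u hu).1) (by
          rintro ⟨u, v⟩ huv ⟨u', v'⟩ hn
          have f := facts u v huv
          simp only [nxt] at hn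
          simp only [act]
          by_cases hX : (u, v) ∈ D
          · simp only [hX, if_true]
            split_ifs <;> omega
          · simp only [hX, if_false]
            have g' : ¬ (u < i ∧ v = j) := by
              rintro ⟨h, rfl⟩; exact hX (hN u (by omega) h)
            split_ifs <;> omega) (by
          rintro ⟨u', v'⟩ hn
          simp only [nxt] at hn ⊢
          split_ifs <;> omega)
        ⟨if l ≤ j then k + j - 1 else k + j - 2, by split_ifs <;> omega⟩
        (by simp only; split_ifs <;> omega)
      have := (vals ⟨if l ≤ j then k + j - 1 else k + j - 2, by split_ifs <;> omega⟩).1 (Or.inl (by simp only; omega))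
      simp only at this
      split_ifs at this <;> omega
    · push Not at hN
      obtain ⟨u0, hu0, hu0', hu0D⟩ := hN
      have hE : ∀ v, j < v → v ≤ b → (i, v) ∈ D := by
        intro v hv hv'
        by_contra hc
        exact c1 ⟨i, j, u0, v, hp, hu0, hu0', hu0D, hv, hv', hc⟩
      have hkl : k < i := by
        by_contra hc
        have : k = i := by omega
        subst this
        exact hq (hE l (by omega) (by omega))
      have tr := trace_wire a b D (fun z => if z.1 = i then i + z.2 else i + b + 1) (k, l)
        Q2 (i, j) (i + j + 1) hch (fun u hu => (h2 u hu).1) (by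
          rintro ⟨u, v⟩ huv ⟨u', v'⟩ hn
          have f := facts u v huv
          simp only [nxt] at hn
          simp only [act]
          by_cases hX : (u, v) ∈ D
          · simp only [hX, if_true]
            split_ifs <;> omega
          · simp only [hX, if_false]
            have g' : ¬ (u = i ∧ j < v) := by
              rintro ⟨rfl, h⟩; exact hX (hE v h (by omega))
            split_ifs <;> omega) (by
          rintro ⟨u', v'⟩ hn
          simp only [nxt] at hn ⊢
          split_ifs <;> omega)
        ⟨i + b - 1, by omega⟩ (by simp only; split_ifs <;> omega)
      have := (vals ⟨i + b - 1, by omega⟩).1 (Or.inr (by simp only; omega))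
      simp only at this
      omega
  · obtain ⟨Q1, Q2, Q3, eQ, h1, h3, h2, hch⟩ := split_boxes a b _ _ hqB hpB hb
    have n2 : ∀ x ∈ Q2, x ≠ (k, l) ∧ x ≠ (i, j) := by
      intro x hx
      obtain ⟨-, hb, hb'⟩ := h2 x hx
      constructor
      · rintro rfl; rcases hb with h | h <;> omega
      · rintro rfl; rcases hb' with h | h <;> omega
    rw [eQ] at e
    have conj := flip_conj _ _ D Q1 Q2 Q3 _ _ h1 h3 n2
      (fun x h h' => (hD x h' h).symm) hq' hp' hq hp e.symm
    rw [PP_congr _ _ D Q2 fun x hx => hD x (n2 x hx).2 (n2 x hx).1] at conj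
    have vals := vals_of_conj _ _ _ (by simp only; omega) (by simp only; omega) _ conj
    simp only [bef] at hb
    have facts : ∀ u v, (u, v) ∈ Q2 → 1 ≤ u ∧ u ≤ a ∧ 1 ≤ v ∧ v ≤ b ∧
        (u < k ∨ (u = k ∧ l < v)) ∧ (i < u ∨ (i = u ∧ v < j)) := by
      intro u v h
      obtain ⟨h, h', h''⟩ := h2 _ h
      rw [mem_boxes] at h
      simp only [bef] at h h' h''
      omega
    by_cases hS : ∀ u, i < u → u ≤ a → (u, j) ∈ D
    · have hkl : ¬ (i < k ∧ l = j) := by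
        rintro ⟨h, rfl⟩; exact hq (hS k h (by omega))
      have tr := trace_wire a b D (fun z => if z.2 ≤ j then z.1 + j + 1 else z.1 + j) (i, j)
        Q2 (k, l) (if l + 1 ≤ j then k + j + 1 else k + j) hch (fun u hu => (h2 u hu).1) (by
          rintro ⟨u, v⟩ huv ⟨u', v'⟩ hn
          have f := facts u v huv
          simp only [nxt] at hn
          simp only [act]
          by_cases hX : (u, v) ∈ D
          · simp only [hX, if_true]
            split_ifs <;> omega
          · simp only [hX, if_false]
            have g' : ¬ (i < u ∧ v = j) := by
              rintro ⟨h, rfl⟩; exact hX (hS u h (by omega))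
            split_ifs <;> omega) (by
          rintro ⟨u', v'⟩ hn
          simp only [nxt] at hn ⊢
          split_ifs <;> omega)
        ⟨i + j - 1, by omega⟩ (by simp; omega)
      have := (vals ⟨i + j - 1, by omega⟩).2 (Or.inr (by simp only; omega))
      simp only at this
      split_ifs at tr <;> omega
    · push Not at hS
      obtain ⟨u0, hu0, hu0', hu0D⟩ := hS
      have hW : ∀ v, 1 ≤ v → v < j → (i, v) ∈ D := by
        intro v hv hv'
        by_contra hc
        exact c2 ⟨i, j, u0, v, hp, hu0, hu0', hu0D, hv, hv', hc⟩
      have hkl : i < k := by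
        by_contra hc
        have : k = i := by omega
        subst this
        exact hq (hW l (by omega) (by omega))
      have tr := trace_wire a b D (fun z => if z.1 = i then i + z.2 else i + 1) (i, j)
        Q2 (k, l) (i + 1) hch (fun u hu => (h2 u hu).1) (by
          rintro ⟨u, v⟩ huv ⟨u', v'⟩ hn
          have f := facts u v huv
          simp only [nxt] at hn
          simp only [act]
          by_cases hX : (u, v) ∈ D
          · simp only [hX, if_true]
            split_ifs <;> omega
          · simp only [hX, if_false]
            have g' : ¬ (u = i ∧ v < j) := by
              rintro ⟨rfl, h⟩; exact hX (hW v (by omega) h)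
            split_ifs <;> omega) (by
          rintro ⟨u', v'⟩ hn
          simp only [nxt] at hn ⊢
          split_ifs <;> omega)
        ⟨i + j - 2, by omega⟩ (by simp; omega)
      have := (vals ⟨i + j - 2, by omega⟩).2 (Or.inl rfl)
      simp only at this
      omega

/-- A reduced rectangular pipe dream `D` of shape `a × b` is rigid if and
only if (1) no cross of `D` has both an elbow to its north and an elbow to its east,
and (2) no cross of `D` has both an elbow to its south and an elbow to its west. -/
theorem rigid_iff_double_Le (a b : ℕ) (D : Finset (ℕ × ℕ))
    (hpd : IsPipeDream a b D) (hred : IsReducedPD a b D) :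
    IsRigid a b D ↔
      ((¬ ∃ i j i' j' : ℕ, (i, j) ∈ D ∧
          1 ≤ i' ∧ i' < i ∧ (i', j) ∉ D ∧
          j < j' ∧ j' ≤ b ∧ (i, j') ∉ D) ∧
       (¬ ∃ i j i' j' : ℕ, (i, j) ∈ D ∧
          i < i' ∧ i' ≤ a ∧ (i', j) ∉ D ∧
          1 ≤ j' ∧ j' < j ∧ (i, j') ∉ D)) := by


  constructor
  · intro hrig
    refine ⟨?_, ?_⟩
    · rintro ⟨i, j, i', j', h1, h2, h3, h4, h5, h6, h7⟩
      exact no_NE a b D hpd hred hrig _ i j i' j' le_rfl h1 h2 h3 h4 h5 h6 h7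
    · rintro ⟨i, j, i', j', h1, h2, h3, h4, h5, h6, h7⟩
      exact no_SW a b D hpd hred hrig _ i j i' j' le_rfl h1 h2 h3 h4 h5 h6 h7
  · rintro ⟨c1, c2⟩
    exact rigid_of a b D hpd hred c1 c2
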